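/- Let {w_k, μ_k, Σ}_{k∈[K]} be the parameters of a SharedGMM on ℝ^d and define the Fisher discriminant J(A) = Tr([AᵀΣA]^{-1}[Aᵀ(Σ_k w_k μ_k μ_kᵀ)A]) for full-column-rank matrices A. Let A_F be any full-column-rank matrix whose column space equals the Fisher subspace S_F = Span{Σ^{-1}μ_k : k∈[K]}. Then J(A) ≤ J(A_F) for every full-column-rank matrix A ∈ ℝ^{d×r} (any r), i.e., projections onto the Fisher subspace achieve the maximum Fisher discriminant. -/

import Mathlib

open Matrix Real

noncomputable section

/-- Fisher discriminant `J(A) = Tr([AᵀΣA]⁻¹ [Aᵀ(∑_k w_k μ_k μ_kᵀ)A])`. -/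
def fisherDiscriminant {d K r : ℕ} (w : Fin K → ℝ) (μ : Fin K → Fin d → ℝ)
    (S : Matrix (Fin d) (Fin d) ℝ) (A : Matrix (Fin d) (Fin r) ℝ) : ℝ :=
  ((Aᵀ * S * A)⁻¹ * (Aᵀ * (∑ k, w k • vecMulVec (μ k) (μ k)) * A)).trace

end

section

variable {d r : ℕ} {S : Matrix (Fin d) (Fin d) ℝ} {A : Matrix (Fin d) (Fin r) ℝ}

/-- The projection of `S⁻¹ v` onto the column space of `A`, orthogonal for the inner product
given by `S`. -/
noncomputable def fisherProjection (S : Matrix (Fin d) (Fin d) ℝ) (A : Matrix (Fin d) (Fin r) ℝ)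
    (v : Fin d → ℝ) : Fin d → ℝ :=
  A *ᵥ ((Aᵀ * S * A)⁻¹ *ᵥ (Aᵀ *ᵥ v))

theorem fisherDiscriminant_eq_sum {K : ℕ} (w : Fin K → ℝ) (μ : Fin K → Fin d → ℝ) :
    fisherDiscriminant w μ S A = ∑ k, w k * (μ k ⬝ᵥ fisherProjection S A (μ k)) := by
  simp only [fisherDiscriminant, fisherProjection, Matrix.mul_sum, Matrix.sum_mul, trace_sum,
    Matrix.mul_smul, Matrix.smul_mul, trace_smul, smul_eq_mul]
  refine Finset.sum_congr rfl fun k _ => ?_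
  rw [mul_vecMulVec, vecMulVec_mul, mul_vecMulVec, trace_vecMulVec, dotProduct_comm,
    ← dotProduct_mulVec]

theorem posDef_transpose_mul_mul (hS : S.PosDef) (hA : Function.Injective A.mulVecLin) :
    (Aᵀ * S * A).PosDef := by
  simpa [conjTranspose_eq_transpose_of_trivial] using hS.conjTranspose_mul_mul_same hA

theorem fisherProjection_mulVec (hS : S.PosDef) (hA : Function.Injective A.mulVecLin)
    (z : Fin r → ℝ) : fisherProjection S A (S *ᵥ (A *ᵥ z)) = A *ᵥ z := by
  have h := (isUnit_iff_isUnit_det _).mp (posDef_transpose_mul_mul hS hA).isUnit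
  have hz : Aᵀ *ᵥ (S *ᵥ (A *ᵥ z)) = (Aᵀ * S * A) *ᵥ z := by
    simp only [mulVec_mulVec, Matrix.mul_assoc]
  rw [fisherProjection, hz, mulVec_mulVec z, nonsing_inv_mul _ h, one_mulVec]

theorem fisherProjection_dotProduct_mulVec_self (hS : S.PosDef)
    (hA : Function.Injective A.mulVecLin) (v : Fin d → ℝ) :
    fisherProjection S A v ⬝ᵥ S *ᵥ fisherProjection S A v = v ⬝ᵥ fisherProjection S A v := by
  have h := (isUnit_iff_isUnit_det _).mp (posDef_transpose_mul_mul hS hA).isUnit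
  have hc : Aᵀ *ᵥ (S *ᵥ fisherProjection S A v) = Aᵀ *ᵥ v := by
    rw [fisherProjection, mulVec_mulVec, mulVec_mulVec, mulVec_mulVec,
      mul_nonsing_inv _ h, one_mulVec]
  have key (u : Fin d → ℝ) : u ⬝ᵥ fisherProjection S A v =
      (Aᵀ *ᵥ u) ⬝ᵥ ((Aᵀ * S * A)⁻¹ *ᵥ (Aᵀ *ᵥ v)) := by
    rw [fisherProjection, dotProduct_mulVec, mulVec_transpose A u]
  rw [dotProduct_comm, key, hc, ← key]

theorem dotProduct_fisherProjection_le (hS : S.PosDef)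
    (hA : Function.Injective A.mulVecLin) (v : Fin d → ℝ) :
    v ⬝ᵥ fisherProjection S A v ≤ v ⬝ᵥ S⁻¹ *ᵥ v := by
  have hv : S *ᵥ (S⁻¹ *ᵥ v) = v := by
    rw [mulVec_mulVec, mul_nonsing_inv _ ((isUnit_iff_isUnit_det _).mp hS.isUnit), one_mulVec]
  have hsymm (x : Fin d → ℝ) : (S⁻¹ *ᵥ v) ⬝ᵥ S *ᵥ x = v ⬝ᵥ x := by
    have hT : Sᵀ = S := by simpa [IsHermitian] using hS.isHermitian
    rw [dotProduct_mulVec, ← mulVec_transpose, hT, hv]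
  have h0 := hS.posSemidef.dotProduct_mulVec_nonneg (S⁻¹ *ᵥ v - fisherProjection S A v)
  rw [star_trivial, mulVec_sub, hv, sub_dotProduct, dotProduct_sub, dotProduct_sub, hsymm,
    fisherProjection_dotProduct_mulVec_self hS hA, dotProduct_comm _ v, dotProduct_comm _ v] at h0
  linarith

end

/-- Any full-column-rank matrix whose column space equals the Fisher
subspace `Span{Σ⁻¹μ_k}` maximizes the Fisher discriminant among all full-column-rank
matrices (of any number of columns). -/
theorem fisherDiscriminant_le_fisherSubspace
    {d K m : ℕ}
    (w : Fin K → ℝ) (μ : Fin K → Fin d → ℝ) (S : Matrix (Fin d) (Fin d) ℝ)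
    (hw : ∀ k, 0 < w k) (hw1 : ∑ k, w k = 1) (hS : S.PosDef)
    (AF : Matrix (Fin d) (Fin m) ℝ)
    (hAF : Function.Injective AF.mulVecLin)
    (hcol : LinearMap.range AF.mulVecLin =
      Submodule.span ℝ (Set.range fun k => S⁻¹.mulVec (μ k))) :
    ∀ (r : ℕ) (A : Matrix (Fin d) (Fin r) ℝ), Function.Injective A.mulVecLin →
      fisherDiscriminant w μ S A ≤ fisherDiscriminant w μ S AF := by
  intro r A hA
  rw [fisherDiscriminant_eq_sum, fisherDiscriminant_eq_sum]
  refine Finset.sum_le_sum fun k _ => mul_le_mul_of_nonneg_left ?_ (hw k).le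
  obtain ⟨z, hz⟩ : S⁻¹ *ᵥ μ k ∈ LinearMap.range AF.mulVecLin :=
    hcol ▸ Submodule.subset_span ⟨k, rfl⟩
  rw [mulVecLin_apply] at hz
  have hμ : S *ᵥ (AF *ᵥ z) = μ k := by
    rw [hz, mulVec_mulVec, mul_nonsing_inv _ ((isUnit_iff_isUnit_det _).mp hS.isUnit), one_mulVec]
  have hF : fisherProjection S AF (μ k) = S⁻¹ *ᵥ μ k := by
    rw [← hz, ← fisherProjection_mulVec hS hAF z, hμ]
  rw [hF]
  exact dotProduct_fisherProjection_le hS hA (μ k)
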